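/- Let A be a positive definite operator on a finite-dimensional complex Hilbert space, H a Hermitian operator, and θ ∈ (−1,1). Then the Fréchet derivative of the matrix power function X ↦ X^θ at A in direction H, defined as D x^θ(A)[H] = lim_{t→0} ((A+tH)^θ − A^θ)/t, satisfies D x^θ(A)[H] = θ·sinc(θπ) · ∫_0^∞ λ^θ (A+λI)^{−1} H (A+λI)^{−1} dλ = θ · ∫_{−∞}^{∞} A^{−(1−θ+it)/2} H A^{−(1−θ−it)/2} β_θ(t) dt. -/

import Mathlib

open scoped BigOperators ComplexOrder Classical
open MeasureTheory Filter Set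

noncomputable section

namespace QHT

variable {ι : Type*} [Fintype ι] [DecidableEq ι]

/-- Generalized matrix power `A ^ w` (complex exponent `w`) of a Hermitian matrix,
via functional calculus on the support: the eigenvalue `0` is mapped to `0`. -/
def mpow (A : Matrix ι ι ℂ) (w : ℂ) : Matrix ι ι ℂ :=
  if hA : A.IsHermitian then
    (hA.eigenvectorUnitary : Matrix ι ι ℂ) *
      Matrix.diagonal (fun i => if hA.eigenvalues i = 0 then 0 else (hA.eigenvalues i : ℂ) ^ w) *
      star (hA.eigenvectorUnitary : Matrix ι ι ℂ)
  else 0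

/-- Matrix logarithm of a Hermitian matrix, taken on its support
(`Real.log 0 = 0`, so the kernel is mapped to `0`). -/
def mlog (A : Matrix ι ι ℂ) : Matrix ι ι ℂ :=
  if hA : A.IsHermitian then
    (hA.eigenvectorUnitary : Matrix ι ι ℂ) *
      Matrix.diagonal (fun i => (Real.log (hA.eigenvalues i) : ℂ)) *
      star (hA.eigenvectorUnitary : Matrix ι ι ℂ)
  else 0

/-- The support of a matrix, i.e. its range as a linear map. -/
def msupp (A : Matrix ι ι ℂ) : Submodule ℂ (ι → ℂ) := LinearMap.range A.mulVecLin

/-- A quantum state: a positive semidefinite matrix of trace one. -/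
def IsState (A : Matrix ι ι ℂ) : Prop := A.PosSemidef ∧ A.trace = 1

/-- Real part of the trace. -/
def rtr (A : Matrix ι ι ℂ) : ℝ := A.trace.re

/-- The Umegaki relative entropy `D(ρ‖σ)`, with value `+∞` when `supp ρ ⊄ supp σ`. -/
def relEnt (ρ σ : Matrix ι ι ℂ) : EReal :=
  if msupp ρ ≤ msupp σ then ((rtr (ρ * (mlog ρ - mlog σ)) : ℝ) : EReal) else ⊤

/-- The polar of a set of matrices (intersected with the PSD cone). -/
def polar (S : Set (Matrix ι ι ℂ)) : Set (Matrix ι ι ℂ) :=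
  {X | X.PosSemidef ∧ ∀ Y ∈ S, rtr (X * Y) ≤ 1}

/-- Entrywise Bochner integral of a matrix-valued function over `ℝ`. -/
def mInt (f : ℝ → Matrix ι ι ℂ) : Matrix ι ι ℂ :=
  Matrix.of fun i j => ∫ t : ℝ, f t i j

/-- Entrywise Bochner integral of a matrix-valued function over a set `s ⊆ ℝ`. -/
def mIntOn (f : ℝ → Matrix ι ι ℂ) (s : Set ℝ) : Matrix ι ι ℂ :=
  Matrix.of fun i j => ∫ t in s, f t i j

/-- `sinc` function. -/
def sinc (s : ℝ) : ℝ := if s = 0 then 1 else Real.sin s / s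

/-- The probability density `β_θ` from the paper (`β₀` is the `θ → 0` limit). -/
def betaDist (θ t : ℝ) : ℝ :=
  if θ = 0 then Real.pi / (2 * (Real.cosh (Real.pi * t) + 1))
  else Real.sin (θ * Real.pi) / (2 * θ * (Real.cosh (Real.pi * t) + Real.cos (θ * Real.pi)))

/-- `Q_{α,z}(ρ‖σ) = Tr[(ρ^{α/2z} σ^{(1-α)/z} ρ^{α/2z})^z]`. -/
def Qaz (α z : ℝ) (ρ σ : Matrix ι ι ℂ) : ℝ :=
  rtr (mpow (mpow ρ ((α / (2 * z) : ℝ) : ℂ) * mpow σ (((1 - α) / z : ℝ) : ℂ) *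
      mpow ρ ((α / (2 * z) : ℝ) : ℂ)) ((z : ℝ) : ℂ))

/-- The `α`-`z` Rényi relative entropy. -/
def Daz (α z : ℝ) (ρ σ : Matrix ι ι ℂ) : EReal :=
  if (α < 1 ∧ (ρ * σ).trace ≠ 0) ∨ msupp ρ ≤ msupp σ then
    (((α - 1)⁻¹ * Real.log (Qaz α z ρ σ) : ℝ) : EReal)
  else ⊤

/-- `Q_α(ρ‖σ) = Tr[ρ^α σ^{1-α}]` (Petz). -/
def Qpetz (α : ℝ) (ρ σ : Matrix ι ι ℂ) : ℝ :=
  rtr (mpow ρ ((α : ℝ) : ℂ) * mpow σ (((1 - α) : ℝ) : ℂ))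

/-- The Petz Rényi divergence. -/
def Dpetz (α : ℝ) (ρ σ : Matrix ι ι ℂ) : EReal :=
  if (α < 1 ∧ (ρ * σ).trace ≠ 0) ∨ msupp ρ ≤ msupp σ then
    (((α - 1)⁻¹ * Real.log (Qpetz α ρ σ) : ℝ) : EReal)
  else ⊤

/-- `Q̃_α(ρ‖σ) = Tr[(σ^{(1-α)/2α} ρ σ^{(1-α)/2α})^α]` (sandwiched). -/
def Qsand (α : ℝ) (ρ σ : Matrix ι ι ℂ) : ℝ :=
  rtr (mpow (mpow σ (((1 - α) / (2 * α) : ℝ) : ℂ) * ρ * mpow σ (((1 - α) / (2 * α) : ℝ) : ℂ))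
    ((α : ℝ) : ℂ))

/-- The sandwiched Rényi divergence. -/
def Dsand (α : ℝ) (ρ σ : Matrix ι ι ℂ) : EReal :=
  if (α < 1 ∧ (ρ * σ).trace ≠ 0) ∨ msupp ρ ≤ msupp σ then
    (((α - 1)⁻¹ * Real.log (Qsand α ρ σ) : ℝ) : EReal)
  else ⊤

/-- `D̃_∞(ρ‖σ)`: the limit of `D̃_α(ρ‖σ)` as `α → +∞` (encoded as a `limsup`; the limit
exists by monotonicity in `α`). -/
def DsandInf (ρ σ : Matrix ι ι ℂ) : EReal :=
  Filter.limsup (fun α : ℝ => Dsand α ρ σ) Filter.atTop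

/-- `χ_{α,z}(ρ,σ) = ρ^{α/2z} (ρ^{α/2z} σ^{(1-α)/z} ρ^{α/2z})^{z-1} ρ^{α/2z}`. -/
def chi (α z : ℝ) (ρ σ : Matrix ι ι ℂ) : Matrix ι ι ℂ :=
  mpow ρ ((α / (2 * z) : ℝ) : ℂ) *
    mpow (mpow ρ ((α / (2 * z) : ℝ) : ℂ) * mpow σ (((1 - α) / z : ℝ) : ℂ) *
      mpow ρ ((α / (2 * z) : ℝ) : ℂ)) (((z - 1 : ℝ)) : ℂ) *
    mpow ρ ((α / (2 * z) : ℝ) : ℂ)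

/-- The data-processing region `𝒟` for `α`-`z` Rényi relative entropies. -/
def Dregion : Set (ℝ × ℝ) :=
  {p | (0 < p.1 ∧ p.1 < 1 ∧ max p.1 (1 - p.1) ≤ p.2) ∨
       (1 < p.1 ∧ max (p.1 / 2) (p.1 - 1) ≤ p.2 ∧ p.2 ≤ p.1) ∨
       (p.1 = 1 ∧ 0 < p.2)}

end QHT

namespace QHT

variable {ι : Type*} [Fintype ι] [DecidableEq ι]

/-! ### Tensor products and many copies -/

/-- Tensor product of a `d₁`- and a `d₂`-dimensional operator, as a `d₁d₂`-dimensional one. -/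
def dtens {a b : ℕ} (A : Matrix (Fin a) (Fin a) ℂ) (B : Matrix (Fin b) (Fin b) ℂ) :
    Matrix (Fin (a * b)) (Fin (a * b)) ℂ :=
  Matrix.of fun x y =>
    A (finProdFinEquiv.symm x).1 (finProdFinEquiv.symm y).1 *
      B (finProdFinEquiv.symm x).2 (finProdFinEquiv.symm y).2

/-- `ρ^{⊗n}` of a `d`-dimensional operator, as a `d^n`-dimensional operator. -/
def dpow {d : ℕ} (ρ : Matrix (Fin d) (Fin d) ℂ) (n : ℕ) :
    Matrix (Fin (d ^ n)) (Fin (d ^ n)) ℂ :=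
  Matrix.of fun x y => ∏ i, ρ (finFunctionFinEquiv.symm x i) (finFunctionFinEquiv.symm y i)

/-- The action of a permutation of the `k` tensor factors on an operator on `(ℂ^d)^{⊗k}`. -/
def permMat (d k : ℕ) (π : Equiv.Perm (Fin k)) (A : Matrix (Fin (d ^ k)) (Fin (d ^ k)) ℂ) :
    Matrix (Fin (d ^ k)) (Fin (d ^ k)) ℂ :=
  Matrix.of fun x y =>
    A (finFunctionFinEquiv ((finFunctionFinEquiv.symm x) ∘ π))
      (finFunctionFinEquiv ((finFunctionFinEquiv.symm y) ∘ π))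

/-- `ρ^{⊗n}` of a `d`-dimensional operator, as an operator on `H^{⊗n}` with `H = ℂ^d`,
indexed by tuples. -/
def tpow {d : ℕ} (ρ : Matrix (Fin d) (Fin d) ℂ) (n : ℕ) :
    Matrix (Fin n → Fin d) (Fin n → Fin d) ℂ :=
  Matrix.of fun x y => ∏ i, ρ (x i) (y i)

/-- Tensor product of an operator on `H^{⊗m}` and an operator on `H^{⊗n}`, as an
operator on `H^{⊗(m+n)}`. -/
def tensOp {d m n : ℕ} (A : Matrix (Fin m → Fin d) (Fin m → Fin d) ℂ)
    (B : Matrix (Fin n → Fin d) (Fin n → Fin d) ℂ) :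
    Matrix (Fin (m + n) → Fin d) (Fin (m + n) → Fin d) ℂ :=
  Matrix.of fun x y =>
    A (fun i => x (Fin.castAdd n i)) (fun i => y (Fin.castAdd n i)) *
      B (fun j => x (Fin.natAdd m j)) (fun j => y (Fin.natAdd m j))

/-- Permutation action on operators on `H^{⊗k}`. -/
def permOp {d k : ℕ} (π : Equiv.Perm (Fin k))
    (A : Matrix (Fin k → Fin d) (Fin k → Fin d) ℂ) :
    Matrix (Fin k → Fin d) (Fin k → Fin d) ℂ :=
  Matrix.of fun x y => A (x ∘ π) (y ∘ π)

/-! ### Hypothesis testing -/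

/-- A test: an operator `T` with `0 ≤ T ≤ I`. -/
def IsTest (T : Matrix ι ι ℂ) : Prop := T.PosSemidef ∧ (1 - T).PosSemidef

/-- Type I error `α_n(ρ|T) = Tr[(I - T) ρ^{⊗n}]`. -/
def typeI {d : ℕ} (ρ : Matrix (Fin d) (Fin d) ℂ) (n : ℕ)
    (T : Matrix (Fin n → Fin d) (Fin n → Fin d) ℂ) : ℝ :=
  rtr ((1 - T) * tpow ρ n)

/-- Type II error `β_n(S|T) = sup_{σ ∈ S} Tr[σ T]`. -/
def typeII {d n : ℕ} (S : Set (Matrix (Fin n → Fin d) (Fin n → Fin d) ℂ))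
    (T : Matrix (Fin n → Fin d) (Fin n → Fin d) ℂ) : ℝ :=
  sSup ((fun σ => rtr (σ * T)) '' S)

/-- `- log x`, valued in `EReal`, with `- log x = +∞` for `x ≤ 0`. -/
def negLog (x : ℝ) : EReal := if x ≤ 0 then ⊤ else ((- Real.log x : ℝ) : EReal)

/-- The exponential rate `-(1/n) log x`. -/
def rate (n : ℕ) (x : ℝ) : EReal := (((n : ℝ)⁻¹ : ℝ) : EReal) * negLog x

/-- The Stein exponent `s(ρ‖{S_n})`. -/
def steinExp {d : ℕ} (ρ : Matrix (Fin d) (Fin d) ℂ)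
    (S : (n : ℕ) → Set (Matrix (Fin n → Fin d) (Fin n → Fin d) ℂ)) : EReal :=
  sSup ((fun r : ℝ => (r : EReal)) ''
    {r : ℝ | 0 ≤ r ∧ ∃ T : (n : ℕ) → Matrix (Fin n → Fin d) (Fin n → Fin d) ℂ,
      (∀ n, IsTest (T n)) ∧
      (r : EReal) ≤ Filter.liminf (fun n => rate n (typeII (S n) (T n))) Filter.atTop ∧
      Filter.Tendsto (fun n => typeI ρ n (T n)) Filter.atTop (nhds 0)})

/-- The Chernoff exponent `c(ρ‖{S_n})`. -/
def chernoffExp {d : ℕ} (ρ : Matrix (Fin d) (Fin d) ℂ)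
    (S : (n : ℕ) → Set (Matrix (Fin n → Fin d) (Fin n → Fin d) ℂ)) : EReal :=
  Filter.liminf (fun n =>
    rate n (sInf ((fun T => typeI ρ n T + typeII (S n) T) '' {T | IsTest T}))) Filter.atTop

/-- The Hoeffding (direct) exponent `d_r(ρ‖{S_n})`. -/
def hoeffdingExp {d : ℕ} (r : ℝ) (ρ : Matrix (Fin d) (Fin d) ℂ)
    (S : (n : ℕ) → Set (Matrix (Fin n → Fin d) (Fin n → Fin d) ℂ)) : EReal :=
  ⨆ T : {T : (n : ℕ) → Matrix (Fin n → Fin d) (Fin n → Fin d) ℂ //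
      (∀ n, IsTest (T n)) ∧
      (r : EReal) ≤ Filter.liminf (fun n => rate n (typeII (S n) (T n))) Filter.atTop},
    Filter.liminf (fun n => rate n (typeI ρ n (T.1 n))) Filter.atTop

/-- The strong converse exponent `sc_r(ρ‖{S_n})`. -/
def scExp {d : ℕ} (r : ℝ) (ρ : Matrix (Fin d) (Fin d) ℂ)
    (S : (n : ℕ) → Set (Matrix (Fin n → Fin d) (Fin n → Fin d) ℂ)) : EReal :=
  ⨅ T : {T : (n : ℕ) → Matrix (Fin n → Fin d) (Fin n → Fin d) ℂ //
      (∀ n, IsTest (T n)) ∧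
      (r : EReal) ≤ Filter.liminf (fun n => rate n (typeII (S n) (T n))) Filter.atTop},
    Filter.limsup (fun n => rate n (1 - typeI ρ n (T.1 n))) Filter.atTop

/-- Assumption 1 of the paper for a family `{S_n}_{n ≥ 1}` of sets of operators
on `H^{⊗n}`, `H = ℂ^d`: each `S_n` is a convex compact set of positive semidefinite
operators, closed under tensor products, and with polar sets closed under tensor
products. -/
structure Assumption1 {d : ℕ}
    (S : (n : ℕ) → Set (Matrix (Fin n → Fin d) (Fin n → Fin d) ℂ)) : Prop where
  psd : ∀ n, 1 ≤ n → ∀ X ∈ S n, X.PosSemidef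
  convex : ∀ n, 1 ≤ n → Convex ℝ (S n)
  compact : ∀ n, 1 ≤ n → IsCompact (S n)
  tens : ∀ m n, 1 ≤ m → 1 ≤ n → ∀ A ∈ S m, ∀ B ∈ S n, tensOp A B ∈ S (m + n)
  polarTens : ∀ m n, 1 ≤ m → 1 ≤ n →
    ∀ A ∈ polar (S m), ∀ B ∈ polar (S n), tensOp A B ∈ polar (S (m + n))

/-- Assumption 1′ of the paper for a dimension-indexed family `{S_d}_{d ≥ 1}`. -/
structure Assumption1' (S : (d : ℕ) → Set (Matrix (Fin d) (Fin d) ℂ)) : Prop where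
  psd : ∀ d, 1 ≤ d → ∀ X ∈ S d, X.PosSemidef
  convex : ∀ d, 1 ≤ d → Convex ℝ (S d)
  compact : ∀ d, 1 ≤ d → IsCompact (S d)
  tens : ∀ d₁ d₂, 1 ≤ d₁ → 1 ≤ d₂ → ∀ A ∈ S d₁, ∀ B ∈ S d₂, dtens A B ∈ S (d₁ * d₂)
  polarTens : ∀ d₁ d₂, 1 ≤ d₁ → 1 ≤ d₂ →
    ∀ A ∈ polar (S d₁), ∀ B ∈ polar (S d₂), dtens A B ∈ polar (S (d₁ * d₂))

end QHT

namespace QHT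

/-- Integrability of the real Gamma kernel. -/
lemma integrableOn_rpow_mul_exp_neg_mul {σ r : ℝ} (hσ : 0 < σ) (hr : 0 < r) :
    IntegrableOn (fun t : ℝ => t ^ (σ - 1) * Real.exp (-(r * t))) (Ioi 0) := by
  apply Integrable.of_integral_ne_zero
  rw [Real.integral_rpow_mul_exp_neg_mul_Ioi hσ hr]
  have := Real.Gamma_pos_of_pos hσ
  positivity

/-- The Beta integral over the half line, for a positive shift. -/
lemma integral_cpow_div_ofReal_add_pow {p : ℕ} (hp : 0 < p) {s : ℂ} (hs : 0 < s.re)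
    (hsp : s.re < p) {a : ℝ} (ha : 0 < a) :
    ∫ l in Ioi (0 : ℝ), (l : ℂ) ^ (s - 1) / ((a : ℂ) + l) ^ p =
      Complex.Gamma s * Complex.Gamma (p - s) / Complex.Gamma p * (a : ℂ) ^ (s - p) := by
  have hp' : (0 : ℝ) < p := by exact_mod_cast hp
  set f : ℝ → ℝ → ℂ := fun l x =>
    (l : ℂ) ^ (s - 1) * ((x : ℂ) ^ ((p : ℂ) - 1) * Complex.exp (-(((a + l : ℝ) : ℂ) * x))) with hf
  have hfswap : ∀ l x : ℝ, f l x = ((x : ℂ) ^ ((p : ℂ) - 1) * Complex.exp (-((a : ℂ) * x))) *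
      ((l : ℂ) ^ (s - 1) * Complex.exp (-((x : ℂ) * l))) := by
    intro l x
    have : Complex.exp (-(((a + l : ℝ) : ℂ) * x)) =
        Complex.exp (-((a : ℂ) * x)) * Complex.exp (-((x : ℂ) * l)) := by
      rw [← Complex.exp_add]; push_cast; ring_nf
    simp only [hf, this]; ring
  have hnorm : ∀ x ∈ Ioi (0 : ℝ), ∀ l ∈ Ioi (0 : ℝ), ‖f l x‖ =
      (x ^ ((p : ℝ) - 1) * Real.exp (-(a * x))) * (l ^ (s.re - 1) * Real.exp (-(x * l))) := by
    intro x hx l hl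
    rw [hfswap, norm_mul, norm_mul, norm_mul, Complex.norm_cpow_eq_rpow_re_of_pos hx,
      Complex.norm_cpow_eq_rpow_re_of_pos hl, Complex.norm_exp, Complex.norm_exp]
    simp
  have hmeas : AEStronglyMeasurable (Function.uncurry f)
      ((volume.restrict (Ioi 0)).prod (volume.restrict (Ioi 0))) := by
    apply Measurable.aestronglyMeasurable
    simp only [hf, Function.uncurry_def]
    fun_prop
  have hw : Integrable (Function.uncurry f)
      ((volume.restrict (Ioi 0)).prod (volume.restrict (Ioi 0))) := by
    rw [integrable_prod_iff' hmeas]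
    constructor
    · filter_upwards [ae_restrict_mem measurableSet_Ioi] with x hx
      have h1 : IntegrableOn (fun l : ℝ => (x ^ ((p : ℝ) - 1) * Real.exp (-(a * x))) *
          (l ^ (s.re - 1) * Real.exp (-(x * l)))) (Ioi 0) :=
        (integrableOn_rpow_mul_exp_neg_mul hs hx).const_mul _
      refine Integrable.mono' h1 ?_ ?_
      · apply Measurable.aestronglyMeasurable
        simp only [hf, Function.uncurry_def]
        fun_prop
      · filter_upwards [ae_restrict_mem measurableSet_Ioi] with l hl
        exact (hnorm x hx l hl).le
    · have h1 : IntegrableOn (fun x : ℝ => Real.Gamma s.re *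
          (x ^ (((p : ℝ) - s.re) - 1) * Real.exp (-(a * x)))) (Ioi 0) :=
        (integrableOn_rpow_mul_exp_neg_mul (by linarith) ha).const_mul _
      refine IntegrableOn.congr_fun h1 (fun x hx => ?_) measurableSet_Ioi
      have hx' : (0 : ℝ) < x := hx
      simp only [Function.uncurry_apply_pair]
      rw [setIntegral_congr_fun measurableSet_Ioi (fun l hl => hnorm x hx l hl),
        integral_const_mul, Real.integral_rpow_mul_exp_neg_mul_Ioi hs hx, one_div,
        Real.inv_rpow hx'.le, ← Real.rpow_neg hx'.le,
        show (p : ℝ) - s.re - 1 = ((p : ℝ) - 1) + (-s.re) by ring, Real.rpow_add hx']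
      ring
  have hswap := integral_integral_swap hw
  have hG : Complex.Gamma p ≠ 0 := Complex.Gamma_ne_zero_of_re_pos (by simpa using hp')
  have hL : ∫ l in Ioi (0 : ℝ), ∫ x in Ioi (0 : ℝ), f l x =
      Complex.Gamma p * ∫ l in Ioi (0 : ℝ), (l : ℂ) ^ (s - 1) / ((a : ℂ) + l) ^ p := by
    rw [← integral_const_mul]
    refine setIntegral_congr_fun measurableSet_Ioi (fun l hl => ?_)
    have hl' : (0 : ℝ) < l := hl
    simp only [hf]
    rw [integral_const_mul, Complex.integral_cpow_mul_exp_neg_mul_Ioi (by simpa using hp')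
      (by positivity), Complex.cpow_natCast]
    rw [one_div, inv_pow]
    push_cast
    ring
  have hR : ∫ x in Ioi (0 : ℝ), ∫ l in Ioi (0 : ℝ), f l x =
      Complex.Gamma s * Complex.Gamma (p - s) * (a : ℂ) ^ (s - p) := by
    have : ∀ x ∈ Ioi (0 : ℝ), ∫ l in Ioi (0 : ℝ), f l x = Complex.Gamma s *
        ((x : ℂ) ^ (((p : ℂ) - s) - 1) * Complex.exp (-((a : ℂ) * x))) := by
      intro x hx
      have hx' : (0 : ℝ) < x := hx
      have hx0 : (x : ℂ) ≠ 0 := by exact_mod_cast hx'.ne'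
      simp_rw [hfswap]
      rw [integral_const_mul, Complex.integral_cpow_mul_exp_neg_mul_Ioi hs hx', one_div,
        Complex.inv_cpow _ _ (by rw [Complex.arg_ofReal_of_nonneg hx'.le]; exact Real.pi_pos.ne),
        ← Complex.cpow_neg, show (p : ℂ) - s - 1 = ((p : ℂ) - 1) + (-s) by ring,
        Complex.cpow_add _ _ hx0]
      ring
    rw [setIntegral_congr_fun measurableSet_Ioi this, integral_const_mul,
      Complex.integral_cpow_mul_exp_neg_mul_Ioi (by simpa using hsp) ha, one_div,
      Complex.inv_cpow _ _ (by rw [Complex.arg_ofReal_of_nonneg ha.le]; exact Real.pi_pos.ne),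
      ← Complex.cpow_neg, neg_sub]
    ring
  rw [hL, hR] at hswap
  field_simp
  linear_combination hswap

/-- A point of the slit plane stays uniformly away from the negative half line. -/
lemma exists_mul_one_add_le_norm_add {a : ℂ} (ha : a ∈ Complex.slitPlane) :
    ∃ c > 0, ∀ b ∈ Metric.ball a c, ∀ l : ℝ, 0 ≤ l → c * (1 + l) ≤ ‖b + l‖ := by
  obtain ⟨δ, hδ, hball⟩ := Metric.isOpen_iff.1 Complex.isOpen_slitPlane a ha
  have h1 : ∀ l : ℝ, 0 ≤ l → δ ≤ ‖a + l‖ := by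
    intro l hl
    by_contra! hlt
    have hmem : (-(l : ℂ)) ∈ Complex.slitPlane := hball (by
      rw [Metric.mem_ball, dist_comm, dist_eq_norm]; simpa using hlt)
    rw [Complex.mem_slitPlane_iff] at hmem
    simp at hmem
    linarith
  set K : ℝ := 1 + (‖a‖ + 1) / δ with hK
  have hKpos : 0 < K := by positivity
  have h2 : ∀ l : ℝ, 0 ≤ l → K⁻¹ * (1 + l) ≤ ‖a + l‖ := by
    intro l hl
    have h3 : l - ‖a‖ ≤ ‖a + l‖ := by
      have := norm_sub_norm_le (l : ℂ) (-a)
      rw [norm_neg, sub_neg_eq_add, add_comm (l : ℂ), Complex.norm_of_nonneg hl] at this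
      exact this
    have h4 : ‖a‖ + 1 ≤ ‖a + l‖ * ((‖a‖ + 1) / δ) := by
      calc ‖a‖ + 1 = δ * ((‖a‖ + 1) / δ) := by field_simp
        _ ≤ _ := by gcongr; exact h1 l hl
    rw [inv_mul_le_iff₀ hKpos, hK]
    linarith
  refine ⟨K⁻¹ / 2, by positivity, fun b hb l hl => ?_⟩
  rw [Metric.mem_ball, dist_eq_norm] at hb
  have h5 : ‖a + l‖ ≤ ‖b + l‖ + ‖b - a‖ := by
    have := norm_sub_le (b + l) (b - a)
    rwa [show b + l - (b - a) = a + l by ring] at this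
  have := h2 l hl
  have hKi : 0 < K⁻¹ := by positivity
  nlinarith [mul_nonneg hKi.le hl]

/-- `∫ l^(s-1) / (a + l) dl` for `a` in the slit plane. -/
lemma integral_cpow_div_add {s a : ℂ} (hs : 0 < s.re) (hs1 : s.re < 1)
    (ha : a ∈ Complex.slitPlane) :
    ∫ l in Ioi (0 : ℝ), (l : ℂ) ^ (s - 1) / (a + l) =
      Complex.Gamma s * Complex.Gamma (1 - s) * a ^ (s - 1) := by
  have hint1 : IntegrableOn (fun l : ℝ => l ^ (s.re - 1) / (1 + l)) (Ioi 0) := by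
    have h := integral_cpow_div_ofReal_add_pow one_pos (s := (s.re : ℂ)) (by simpa using hs)
      (by simpa using hs1) one_pos
    have h' : IntegrableOn
        (fun l : ℝ => (l : ℂ) ^ ((s.re : ℂ) - 1) / (((1 : ℝ) : ℂ) + l) ^ 1) (Ioi 0) := by
      apply Integrable.of_integral_ne_zero
      rw [h]
      have e1 : Complex.Gamma (s.re : ℂ) ≠ 0 :=
        Complex.Gamma_ne_zero_of_re_pos (by simpa using hs)
      have e2 : Complex.Gamma (((1 : ℕ) : ℂ) - s.re) ≠ 0 :=
        Complex.Gamma_ne_zero_of_re_pos (by simpa using hs1)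
      simpa [e1] using e2
    refine IntegrableOn.congr_fun h'.norm (fun l hl => ?_) measurableSet_Ioi
    have hl' : (0 : ℝ) < l := hl
    rw [norm_div, Complex.norm_cpow_eq_rpow_re_of_pos hl', pow_one, ← Complex.ofReal_add,
      Complex.norm_of_nonneg (by positivity)]
    simp
  have hdiff : DifferentiableOn ℂ
      (fun a : ℂ => ∫ l in Ioi (0 : ℝ), (l : ℂ) ^ (s - 1) / (a + l)) Complex.slitPlane := by
    intro a ha
    obtain ⟨c, hc, hbound⟩ := exists_mul_one_add_le_norm_add ha
    have hmeas : ∀ b : ℂ, AEStronglyMeasurable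
        (fun l : ℝ => (l : ℂ) ^ (s - 1) / (b + l)) (volume.restrict (Ioi 0)) := by
      intro b
      apply Measurable.aestronglyMeasurable
      fun_prop
    have key := hasDerivAt_integral_of_dominated_loc_of_deriv_le (𝕜 := ℂ)
      (μ := volume.restrict (Ioi (0 : ℝ)))
      (F := fun (b : ℂ) (l : ℝ) => (l : ℂ) ^ (s - 1) / (b + l))
      (F' := fun (b : ℂ) (l : ℝ) => -((l : ℂ) ^ (s - 1) / (b + l) ^ 2))
      (bound := fun l : ℝ => (c ^ 2)⁻¹ * (l ^ (s.re - 1) / (1 + l)))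
      (x₀ := a) (Metric.ball_mem_nhds a hc) (Eventually.of_forall hmeas) ?_ ?_ ?_
      (hint1.const_mul _) ?_
    · exact key.2.differentiableAt.differentiableWithinAt
    · refine Integrable.mono' (hint1.const_mul c⁻¹) (hmeas a) ?_
      filter_upwards [ae_restrict_mem measurableSet_Ioi] with l hl
      have hl' : (0 : ℝ) < l := hl
      have := hbound a (Metric.mem_ball_self hc) l hl'.le
      rw [norm_div, Complex.norm_cpow_eq_rpow_re_of_pos hl', inv_mul_eq_div, div_div]
      simp only [Complex.sub_re, Complex.one_re]
      gcongr
      linarith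
    · apply Measurable.aestronglyMeasurable
      fun_prop
    · filter_upwards [ae_restrict_mem measurableSet_Ioi] with l hl b hb
      have hl' : (0 : ℝ) < l := hl
      have := hbound b hb l hl'.le
      rw [norm_neg, norm_div, Complex.norm_cpow_eq_rpow_re_of_pos hl', inv_mul_eq_div, div_div,
        norm_pow]
      simp only [Complex.sub_re, Complex.one_re]
      gcongr
      calc (1 + l) * c ^ 2 ≤ (1 + l) ^ 2 * c ^ 2 := by gcongr; nlinarith
        _ = (c * (1 + l)) ^ 2 := by ring
        _ ≤ _ := by gcongr
    · filter_upwards [ae_restrict_mem measurableSet_Ioi] with l hl b hb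
      have hl' : (0 : ℝ) < l := hl
      have h1 := hbound b hb l hl'.le
      have hne : b + l ≠ 0 := by
        rw [← norm_pos_iff]
        exact lt_of_lt_of_le (by positivity) h1
      have h2 := (((hasDerivAt_id b).add_const (l : ℂ)).inv hne).const_mul ((l : ℂ) ^ (s - 1))
      convert! h2 using 1
      simp [div_eq_mul_inv]
  have hdiff2 : DifferentiableOn ℂ
      (fun a : ℂ => Complex.Gamma s * Complex.Gamma (1 - s) * a ^ (s - 1)) Complex.slitPlane :=
    fun a ha => ((differentiableAt_id.cpow_const ha).const_mul _).differentiableWithinAt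
  refine AnalyticOnNhd.eqOn_of_preconnected_of_frequently_eq
    (hdiff.analyticOnNhd Complex.isOpen_slitPlane) (hdiff2.analyticOnNhd Complex.isOpen_slitPlane)
    ?_ (z₀ := 1) Complex.one_mem_slitPlane ?_ ha
  · exact (Complex.starConvex_one_slitPlane.isPathConnected
      Complex.one_mem_slitPlane).isConnected.isPreconnected
  · have ht : Tendsto (fun x : ℝ => (x : ℂ)) (nhdsWithin 1 (Ioi 1)) (nhdsWithin 1 {1}ᶜ) := by
      refine tendsto_nhdsWithin_iff.2 ⟨?_, ?_⟩
      · exact (Complex.continuous_ofReal.tendsto' 1 1 (by simp)).mono_left nhdsWithin_le_nhds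
      · filter_upwards [self_mem_nhdsWithin] with x hx
        have hx' : (1 : ℝ) < x := hx
        simpa using hx'.ne'
    refine ht.frequently (Eventually.frequently ?_)
    filter_upwards [self_mem_nhdsWithin] with x hx
    have hx' : (1 : ℝ) < x := hx
    have := integral_cpow_div_ofReal_add_pow one_pos hs (by simpa using hs1)
      (show (0 : ℝ) < x by linarith)
    simpa using this

/-- The resolvent kernel `1 / ((a + l) (b + l))`. -/
def resolventKernel (a b : ℂ) (l : ℝ) : ℂ := ((a + l) * (b + l))⁻¹

lemma ne_zero_of_mem_slitPlane_add {a : ℂ} (ha : a ∈ Complex.slitPlane) {l : ℝ} (hl : 0 ≤ l) :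
    a + l ≠ 0 := by
  obtain ⟨c, hc, h⟩ := exists_mul_one_add_le_norm_add ha
  rw [← norm_pos_iff]
  exact lt_of_lt_of_le (by positivity) (h a (Metric.mem_ball_self hc) l hl)

lemma locallyIntegrableOn_resolventKernel {a b : ℂ} (ha : a ∈ Complex.slitPlane)
    (hb : b ∈ Complex.slitPlane) : LocallyIntegrableOn (resolventKernel a b) (Ioi 0) := by
  refine ContinuousOn.locallyIntegrableOn (fun l hl => ?_) measurableSet_Ioi
  have hl' : (0 : ℝ) ≤ l := le_of_lt hl
  unfold resolventKernel
  refine ContinuousAt.continuousWithinAt (ContinuousAt.inv₀ (by fun_prop) ?_)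
  exact mul_ne_zero (ne_zero_of_mem_slitPlane_add ha hl') (ne_zero_of_mem_slitPlane_add hb hl')

lemma exists_norm_resolventKernel_le {a b : ℂ} (ha : a ∈ Complex.slitPlane)
    (hb : b ∈ Complex.slitPlane) :
    ∃ C : ℝ, 0 < C ∧ ∀ l : ℝ, 0 ≤ l → ‖resolventKernel a b l‖ ≤ C * ((1 + l) ^ 2)⁻¹ := by
  obtain ⟨c, hc, h⟩ := exists_mul_one_add_le_norm_add ha
  obtain ⟨c', hc', h'⟩ := exists_mul_one_add_le_norm_add hb
  refine ⟨(c * c')⁻¹, by positivity, fun l hl => ?_⟩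
  have h1 := h a (Metric.mem_ball_self hc) l hl
  have h2 := h' b (Metric.mem_ball_self hc') l hl
  rw [resolventKernel, norm_inv, norm_mul, ← mul_inv]
  refine inv_anti₀ (by positivity) ?_
  calc c * c' * (1 + l) ^ 2 = (c * (1 + l)) * (c' * (1 + l)) := by ring
    _ ≤ _ := by gcongr

lemma resolventKernel_isBigO_atTop {a b : ℂ} (ha : a ∈ Complex.slitPlane)
    (hb : b ∈ Complex.slitPlane) :
    resolventKernel a b =O[atTop] (fun l : ℝ => l ^ (-(2 : ℝ))) := by
  obtain ⟨C, hC, h⟩ := exists_norm_resolventKernel_le ha hb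
  refine Asymptotics.IsBigO.of_bound C ?_
  filter_upwards [eventually_gt_atTop 0] with l hl
  refine (h l hl.le).trans ?_
  rw [Real.rpow_neg hl.le, Real.norm_of_nonneg (by positivity), Real.rpow_two]
  gcongr
  linarith

lemma resolventKernel_isBigO_zero {a b : ℂ} (ha : a ∈ Complex.slitPlane)
    (hb : b ∈ Complex.slitPlane) :
    resolventKernel a b =O[nhdsWithin 0 (Ioi 0)] (fun l : ℝ => l ^ (-(0 : ℝ))) := by
  obtain ⟨C, hC, h⟩ := exists_norm_resolventKernel_le ha hb
  refine Asymptotics.IsBigO.of_bound C ?_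
  filter_upwards [self_mem_nhdsWithin] with l hl
  have hl' : (0 : ℝ) < l := hl
  refine (h l hl'.le).trans ?_
  simp only [neg_zero, Real.rpow_zero, norm_one]
  gcongr
  exact inv_le_one_of_one_le₀ (by nlinarith)

lemma mellinConvergent_resolventKernel {a b w : ℂ} (ha : a ∈ Complex.slitPlane)
    (hb : b ∈ Complex.slitPlane) (hw : -1 < w.re) (hw1 : w.re < 1) :
    MellinConvergent (resolventKernel a b) (w + 1) :=
  mellinConvergent_of_isBigO_rpow (locallyIntegrableOn_resolventKernel ha hb)
    (resolventKernel_isBigO_atTop ha hb) (by simp; linarith)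
    (resolventKernel_isBigO_zero ha hb) (by simp; linarith)

lemma differentiableAt_mellin_resolventKernel {a b w : ℂ} (ha : a ∈ Complex.slitPlane)
    (hb : b ∈ Complex.slitPlane) (hw : -1 < w.re) (hw1 : w.re < 1) :
    DifferentiableAt ℂ (fun w => mellin (resolventKernel a b) (w + 1)) w := by
  have h : DifferentiableAt ℂ (mellin (resolventKernel a b)) (w + 1) :=
    mellin_differentiableAt_of_isBigO_rpow (locallyIntegrableOn_resolventKernel ha hb)
    (resolventKernel_isBigO_atTop ha hb) (by simp; linarith)
    (resolventKernel_isBigO_zero ha hb) (by simp; linarith)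
  have := DifferentiableAt.comp (g := mellin (resolventKernel a b)) (f := fun w : ℂ => w + 1) w h
    (by fun_prop)
  exact this

/-- The Mellin transform of the resolvent kernel, as a divided difference of powers. -/
lemma mellin_resolventKernel {a b w : ℂ} (ha : a ∈ Complex.slitPlane)
    (hb : b ∈ Complex.slitPlane) (hw : -1 < w.re) (hw1 : w.re < 1) :
    Complex.sin (Real.pi * w) * ((b - a) * mellin (resolventKernel a b) (w + 1)) =
      Real.pi * (b ^ w - a ^ w) := by
  have ha0 := Complex.slitPlane_ne_zero ha
  have hb0 := Complex.slitPlane_ne_zero hb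
  set U : Set ℂ := Complex.re ⁻¹' Ioo (-1) 1 with hU
  have hUo : IsOpen U := isOpen_Ioo.preimage Complex.continuous_re
  have hUc : IsPreconnected U :=
    ((convex_Ioo (-1 : ℝ) 1).linear_preimage Complex.reLm).isPreconnected
  have hd1 : DifferentiableOn ℂ (fun w => Complex.sin (Real.pi * w) *
      ((b - a) * mellin (resolventKernel a b) (w + 1))) U := by
    intro z hz
    have := differentiableAt_mellin_resolventKernel ha hb hz.1 hz.2
    exact DifferentiableAt.differentiableWithinAt (by fun_prop)
  have hd2 : DifferentiableOn ℂ (fun w => Real.pi * (b ^ w - a ^ w)) U := by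
    intro z hz
    have h1 : DifferentiableAt ℂ (fun w : ℂ => b ^ w) z :=
      differentiableAt_id.const_cpow (Or.inl hb0)
    have h2 : DifferentiableAt ℂ (fun w : ℂ => a ^ w) z :=
      differentiableAt_id.const_cpow (Or.inl ha0)
    exact DifferentiableAt.differentiableWithinAt (by fun_prop)
  refine AnalyticOnNhd.eqOn_of_preconnected_of_eventuallyEq
    (hd1.analyticOnNhd hUo) (hd2.analyticOnNhd hUo) hUc (z₀ := -1 / 2)
    (by simp [hU]; norm_num) ?_ (show w ∈ U from ⟨hw, hw1⟩)
  have hnb : Complex.re ⁻¹' Ioo (-1) 0 ∈ nhds (-1 / 2 : ℂ) :=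
    (isOpen_Ioo.preimage Complex.continuous_re).mem_nhds (by simp; norm_num)
  filter_upwards [hnb] with z hz
  have hz1 : -1 < z.re := hz.1
  have hz2 : z.re < 0 := hz.2
  have hJ : ∀ c ∈ Complex.slitPlane, ∫ l in Ioi (0 : ℝ), (l : ℂ) ^ z / (c + l) =
      Complex.Gamma (z + 1) * Complex.Gamma (1 - (z + 1)) * c ^ z := by
    intro c hc
    have := integral_cpow_div_add (s := z + 1) (by simp; linarith) (by simp; linarith) hc
    simpa only [add_sub_cancel_right] using this
  have hGne : Complex.Gamma (z + 1) * Complex.Gamma (1 - (z + 1)) ≠ 0 :=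
    mul_ne_zero (Complex.Gamma_ne_zero_of_re_pos (by simp; linarith))
      (Complex.Gamma_ne_zero_of_re_pos (by simp; linarith))
  have hI : ∀ c ∈ Complex.slitPlane,
      IntegrableOn (fun l : ℝ => (l : ℂ) ^ z / (c + l)) (Ioi 0) := by
    intro c hc
    apply Integrable.of_integral_ne_zero
    rw [hJ c hc]
    exact mul_ne_zero hGne (by simp [Complex.cpow_eq_zero_iff, Complex.slitPlane_ne_zero hc])
  have hM : (b - a) * mellin (resolventKernel a b) (z + 1) =
      Complex.Gamma (z + 1) * Complex.Gamma (1 - (z + 1)) * (a ^ z - b ^ z) := by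
    rw [mul_sub, ← hJ a ha, ← hJ b hb, ← integral_sub (hI a ha) (hI b hb), mellin,
      ← integral_const_mul]
    refine setIntegral_congr_fun measurableSet_Ioi (fun l hl => ?_)
    have hl' : (0 : ℝ) ≤ l := le_of_lt hl
    have h1 := ne_zero_of_mem_slitPlane_add ha hl'
    have h2 := ne_zero_of_mem_slitPlane_add hb hl'
    simp only [resolventKernel, add_sub_cancel_right, smul_eq_mul]
    field_simp
    ring
  rw [hM, Complex.Gamma_mul_Gamma_one_sub, mul_add, mul_one, Complex.sin_add_pi]
  have hsin : Complex.sin (Real.pi * z) ≠ 0 := by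
    intro h0
    rw [Complex.Gamma_mul_Gamma_one_sub, mul_add, mul_one, Complex.sin_add_pi, h0] at hGne
    simp at hGne
  field_simp
  ring

/-- The value at `0` of the Mellin transform of the resolvent kernel. -/
lemma mellin_resolventKernel_one {a b : ℂ} (ha : a ∈ Complex.slitPlane)
    (hb : b ∈ Complex.slitPlane) :
    (b - a) * mellin (resolventKernel a b) 1 = Complex.log b - Complex.log a := by
  have ha0 := Complex.slitPlane_ne_zero ha
  have hb0 := Complex.slitPlane_ne_zero hb
  have hd := (differentiableAt_mellin_resolventKernel ha hb (w := 0) (by simp) (by simp)).hasDerivAt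
  have hs : HasDerivAt (fun w : ℂ => Complex.sin (Real.pi * w)) (Real.pi) 0 := by
    have := ((hasDerivAt_id (0 : ℂ)).const_mul (Real.pi : ℂ)).csin
    simpa using this
  have h1 := hs.mul (hd.const_mul (b - a))
  have h2 : HasDerivAt (fun w : ℂ => Real.pi * (b ^ w - a ^ w))
      (Real.pi * (Complex.log b - Complex.log a)) 0 := by
    have e1 := (hasDerivAt_id (0 : ℂ)).const_cpow (c := b) (Or.inl hb0)
    have e2 := (hasDerivAt_id (0 : ℂ)).const_cpow (c := a) (Or.inl ha0)
    have := (e1.sub e2).const_mul (Real.pi : ℂ)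
    simpa using this
  have heq : (fun w : ℂ => Real.pi * (b ^ w - a ^ w)) =ᶠ[nhds 0] fun w =>
      Complex.sin (Real.pi * w) * ((b - a) * mellin (resolventKernel a b) (w + 1)) := by
    have hnb : Complex.re ⁻¹' Ioo (-1) 1 ∈ nhds (0 : ℂ) :=
      (isOpen_Ioo.preimage Complex.continuous_re).mem_nhds (by simp)
    filter_upwards [hnb] with z hz
    exact (mellin_resolventKernel ha hb hz.1 hz.2).symm
  have h3 := h1.unique (h2.congr_of_eventuallyEq heq.symm)
  have hpi : (Real.pi : ℂ) ≠ 0 := by exact_mod_cast Real.pi_ne_zero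
  simp only [mul_zero, Complex.sin_zero, zero_mul, add_zero, zero_add] at h3
  exact mul_left_cancel₀ hpi h3

lemma mul_sinc_mul_pi (θ : ℝ) : θ * sinc (θ * Real.pi) = Real.sin (θ * Real.pi) / Real.pi := by
  have := Real.pi_ne_zero
  unfold sinc
  split_ifs with h
  · have : θ = 0 := by simpa [Real.pi_ne_zero] using h
    simp [this]
  · have : θ ≠ 0 := by rintro rfl; simp at h
    field_simp

lemma abs_mul_pi_lt {θ : ℝ} (hθ : θ ∈ Ioo (-1 : ℝ) 1) :
    -Real.pi < θ * Real.pi ∧ θ * Real.pi < Real.pi := by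
  have := Real.pi_pos
  constructor <;> nlinarith [hθ.1, hθ.2]

lemma sin_mul_pi_ne_zero {θ : ℝ} (hθ : θ ∈ Ioo (-1 : ℝ) 1) (h0 : θ ≠ 0) :
    Real.sin (θ * Real.pi) ≠ 0 := by
  obtain ⟨h1, h2⟩ := abs_mul_pi_lt hθ
  rw [Ne, Real.sin_eq_zero_iff_of_lt_of_lt h1 h2]
  exact mul_ne_zero h0 Real.pi_ne_zero

lemma log_exp_mul_I {φ : ℝ} (h1 : -Real.pi < φ) (h2 : φ < Real.pi) :
    Complex.log (Complex.exp (φ * Complex.I)) = φ * Complex.I :=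
  Complex.log_exp (by simpa using h1) (by simpa using h2.le)

lemma exp_mul_I_mem_slitPlane {φ : ℝ} (h1 : -Real.pi < φ) (h2 : φ < Real.pi) :
    Complex.exp (φ * Complex.I) ∈ Complex.slitPlane := by
  refine Complex.mem_slitPlane_iff_arg.2 ⟨?_, Complex.exp_ne_zero _⟩
  rw [← Complex.log_im, log_exp_mul_I h1 h2]
  simpa using h2.ne

/-- The resolvent kernel at conjugate points of the unit circle, in exponential coordinates. -/
lemma exp_mul_resolventKernel_exp (φ u : ℝ) :
    (Real.exp (-u) : ℂ) * resolventKernel (Complex.exp (φ * Complex.I))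
      (Complex.exp ((-φ : ℝ) * Complex.I)) (Real.exp (-u)) =
      ((2 * (Real.cosh u + Real.cos φ))⁻¹ : ℝ) := by
  have hx : (Complex.exp (-u : ℂ)) ≠ 0 := Complex.exp_ne_zero _
  have key : (Complex.exp (φ * Complex.I) + Complex.exp (-u)) *
      (Complex.exp ((-φ : ℝ) * Complex.I) + Complex.exp (-u)) =
      Complex.exp (-u) * (2 * (Complex.cosh u + Complex.cos φ)) := by
    have e1 : Complex.exp (φ * Complex.I) * Complex.exp ((-φ : ℝ) * Complex.I) = 1 := by
      rw [← Complex.exp_add]; simp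
    have e2 : Complex.exp (-u : ℂ) * Complex.exp (u : ℂ) = 1 := by
      rw [← Complex.exp_add]; simp
    rw [Complex.cosh, Complex.cos]
    push_cast at e1 ⊢
    linear_combination e1 - e2
  simp only [resolventKernel]
  push_cast at key ⊢
  rw [key, mul_inv, ← mul_assoc, mul_inv_cancel₀ hx, one_mul]

/-- The characteristic function of `betaDist` as a Mellin transform. -/
lemma integral_betaDist_mul_exp {θ : ℝ} (h0 : θ ≠ 0) (r : ℝ) :
    ∫ t : ℝ, (betaDist θ t : ℂ) * Complex.exp (Complex.I * r * t) =
      (Real.sin (θ * Real.pi) / (θ * Real.pi) : ℝ) *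
        mellin (resolventKernel (Complex.exp ((θ * Real.pi : ℝ) * Complex.I))
          (Complex.exp ((-(θ * Real.pi) : ℝ) * Complex.I))) (-(Complex.I * r / Real.pi) + 1) := by
  have hpi := Real.pi_ne_zero
  have hpi' : (Real.pi : ℂ) ≠ 0 := by exact_mod_cast hpi
  have him : (-(Complex.I * r / Real.pi) + 1).im = -(r / Real.pi) := by
    simp [Complex.div_im, Complex.normSq]
    field_simp
  have hre : (-(Complex.I * r / Real.pi) + 1).re = 1 := by
    simp [Complex.div_re, Complex.normSq]
  rw [mellin_eq_fourier, him, hre, Real.fourier_eq']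
  set g : ℝ → ℂ := fun u => ((2 * (Real.cosh u + Real.cos (θ * Real.pi)))⁻¹ : ℝ) *
    Complex.exp (Complex.I * (r / Real.pi : ℝ) * u) with hg
  have h1 : ∀ t : ℝ, (betaDist θ t : ℂ) * Complex.exp (Complex.I * r * t) =
      (Real.sin (θ * Real.pi) / θ : ℝ) * g (Real.pi * t) := by
    intro t
    have e : Complex.I * (r / Real.pi : ℝ) * (Real.pi * t : ℝ) = Complex.I * r * t := by
      push_cast; field_simp
    simp only [hg, e, betaDist, if_neg h0]
    rw [← mul_assoc, ← Complex.ofReal_mul]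
    congr 2
    simp only [div_eq_mul_inv, mul_inv]
    ring
  simp_rw [h1]
  rw [integral_const_mul, Measure.integral_comp_mul_left, abs_of_pos (inv_pos.2 Real.pi_pos)]
  have h2 : ∀ u : ℝ, g u = Complex.exp (((-2 * Real.pi * inner ℝ u (-(r / Real.pi) /
      (2 * Real.pi)) : ℝ) : ℂ) * Complex.I) • (Real.exp (-1 * u) •
        resolventKernel (Complex.exp ((θ * Real.pi : ℝ) * Complex.I))
          (Complex.exp ((-(θ * Real.pi) : ℝ) * Complex.I)) (Real.exp (-u))) := by
    intro u
    have e1 : -2 * Real.pi * inner ℝ u (-(r / Real.pi) / (2 * Real.pi)) = r / Real.pi * u := by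
      simp
      field_simp
    rw [e1, Complex.real_smul, neg_one_mul, exp_mul_resolventKernel_exp]
    simp only [hg, smul_eq_mul]
    push_cast
    ring_nf
  simp_rw [← h2, Complex.real_smul]
  push_cast
  field_simp

/-- `betaDist` integrates to one. -/
lemma integral_betaDist {θ : ℝ} (hθ : θ ∈ Ioo (-1 : ℝ) 1) (h0 : θ ≠ 0) :
    ∫ t : ℝ, (betaDist θ t : ℂ) = 1 := by
  obtain ⟨h1, h2⟩ := abs_mul_pi_lt hθ
  have hpi : (Real.pi : ℂ) ≠ 0 := by exact_mod_cast Real.pi_ne_zero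
  have hθ0 : (θ : ℂ) ≠ 0 := by exact_mod_cast h0
  have h := integral_betaDist_mul_exp h0 0
  have h' := mellin_resolventKernel_one (exp_mul_I_mem_slitPlane h1 h2)
    (exp_mul_I_mem_slitPlane (neg_lt_neg h2) (neg_lt.1 h1))
  rw [log_exp_mul_I h1 h2, log_exp_mul_I (neg_lt_neg h2) (neg_lt.1 h1)] at h'
  simp only [Complex.ofReal_zero, mul_zero, zero_mul, Complex.exp_zero, mul_one, zero_div,
    neg_zero, zero_add] at h
  rw [h]
  set M := mellin (resolventKernel (Complex.exp ((θ * Real.pi : ℝ) * Complex.I))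
          (Complex.exp ((-(θ * Real.pi) : ℝ) * Complex.I))) 1
  have e : Complex.exp ((-(θ * Real.pi) : ℝ) * Complex.I) -
      Complex.exp ((θ * Real.pi : ℝ) * Complex.I) =
      -2 * Complex.I * Complex.sin (θ * Real.pi : ℝ) := by
    rw [Complex.sin]
    push_cast
    linear_combination (Complex.exp (-(θ * Real.pi) * Complex.I) -
      Complex.exp (θ * Real.pi * Complex.I)) * Complex.I_sq
  rw [e] at h'
  push_cast at h' ⊢
  field_simp
  have hI := Complex.I_ne_zero
  apply mul_left_cancel₀ (mul_ne_zero two_ne_zero hI)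
  linear_combination -h'

lemma integrable_betaDist {θ : ℝ} (hθ : θ ∈ Ioo (-1 : ℝ) 1) (h0 : θ ≠ 0) :
    Integrable (fun t : ℝ => (betaDist θ t : ℂ)) := by
  apply Integrable.of_integral_ne_zero
  rw [integral_betaDist hθ h0]
  exact one_ne_zero

/-- The characteristic function of `betaDist` is a quotient of hyperbolic sines. -/
lemma sinh_mul_integral_betaDist_mul_exp {θ : ℝ} (hθ : θ ∈ Ioo (-1 : ℝ) 1) (h0 : θ ≠ 0) (r : ℝ) :
    θ * Complex.sinh r * ∫ t : ℝ, (betaDist θ t : ℂ) * Complex.exp (Complex.I * r * t) =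
      Complex.sinh (θ * r) := by
  obtain ⟨h1, h2⟩ := abs_mul_pi_lt hθ
  have hpi : (Real.pi : ℂ) ≠ 0 := by exact_mod_cast Real.pi_ne_zero
  have hθ0 : (θ : ℂ) ≠ 0 := by exact_mod_cast h0
  have hre : (-(Complex.I * r / Real.pi)).re = 0 := by
    simp [Complex.div_re, Complex.normSq]
  have h' := mellin_resolventKernel (w := -(Complex.I * r / Real.pi))
    (exp_mul_I_mem_slitPlane h1 h2)
    (exp_mul_I_mem_slitPlane (neg_lt_neg h2) (neg_lt.1 h1)) (by rw [hre]; simp) (by rw [hre]; simp)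
  rw [integral_betaDist_mul_exp h0 r]
  set M := mellin (resolventKernel (Complex.exp ((θ * Real.pi : ℝ) * Complex.I))
          (Complex.exp ((-(θ * Real.pi) : ℝ) * Complex.I))) (-(Complex.I * r / Real.pi) + 1)
  have e : Complex.exp ((-(θ * Real.pi) : ℝ) * Complex.I) -
      Complex.exp ((θ * Real.pi : ℝ) * Complex.I) =
      -2 * Complex.I * Complex.sin (θ * Real.pi : ℝ) := by
    rw [Complex.sin]
    push_cast
    linear_combination (Complex.exp (-(θ * Real.pi) * Complex.I) -
      Complex.exp (θ * Real.pi * Complex.I)) * Complex.I_sq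
  have e2 : Complex.sin (Real.pi * -(Complex.I * r / Real.pi)) = -(Complex.sinh r * Complex.I) := by
    rw [show (Real.pi : ℂ) * -(Complex.I * r / Real.pi) = -(r * Complex.I) by field_simp,
      Complex.sin_neg, Complex.sin_mul_I]
  rw [e, e2, Complex.cpow_def_of_ne_zero (Complex.exp_ne_zero _),
    Complex.cpow_def_of_ne_zero (Complex.exp_ne_zero _), log_exp_mul_I h1 h2,
    log_exp_mul_I (neg_lt_neg h2) (neg_lt.1 h1)] at h'
  have e3 : ((-(θ * Real.pi) : ℝ) : ℂ) * Complex.I * -(Complex.I * r / Real.pi) = -(θ * r) := by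
    push_cast; field_simp; linear_combination r * Complex.I_sq
  have e4 : ((θ * Real.pi : ℝ) : ℂ) * Complex.I * -(Complex.I * r / Real.pi) = θ * r := by
    push_cast; field_simp; linear_combination (-r) * Complex.I_sq
  rw [e3, e4] at h'
  rw [Complex.sinh.eq_1 (θ * r)]
  push_cast at h' ⊢
  field_simp
  linear_combination -h' + 2 * Complex.sinh r * Complex.sin (θ * Real.pi) * M * Complex.I_sq

/-- The multiple of the resolvent integral giving the divided difference of `x ↦ x ^ θ`. -/
def powerKernel (θ a b : ℝ) : ℂ :=
  (θ * sinc (θ * Real.pi) : ℝ) * mellin (resolventKernel a b) (θ + 1)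

lemma sub_mul_powerKernel {θ a b : ℝ} (hθ : θ ∈ Ioo (-1 : ℝ) 1) (ha : 0 < a) (hb : 0 < b) :
    ((b : ℂ) - a) * powerKernel θ a b = (b : ℂ) ^ (θ : ℂ) - (a : ℂ) ^ (θ : ℂ) := by
  have hpi : (Real.pi : ℂ) ≠ 0 := by exact_mod_cast Real.pi_ne_zero
  have h := mellin_resolventKernel (w := θ) (Complex.ofReal_mem_slitPlane.2 ha)
    (Complex.ofReal_mem_slitPlane.2 hb) hθ.1 hθ.2
  rw [powerKernel, mul_sinc_mul_pi]
  rw [mul_comm (Real.pi : ℂ)] at h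
  push_cast at h ⊢
  field_simp
  linear_combination h

lemma powerKernel_self {θ a : ℝ} (hθ : θ ∈ Ioo (-1 : ℝ) 1) (h0 : θ ≠ 0) (ha : 0 < a) :
    powerKernel θ a a = θ * (a : ℂ) ^ ((θ : ℂ) - 1) := by
  have hpi : (Real.pi : ℂ) ≠ 0 := by exact_mod_cast Real.pi_ne_zero
  have hsin : Complex.sin (θ * Real.pi) ≠ 0 := by exact_mod_cast sin_mul_pi_ne_zero hθ h0
  have hm : mellin (resolventKernel a a) (θ + 1) =
      Complex.Gamma (θ + 1) * Complex.Gamma (1 - θ) * (a : ℂ) ^ ((θ : ℂ) - 1) := by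
    have h := integral_cpow_div_ofReal_add_pow two_pos (s := (θ : ℂ) + 1)
      (by simp; linarith [hθ.1]) (by simp; linarith [hθ.2]) ha
    rw [mellin]
    simp only [resolventKernel, smul_eq_mul, ← pow_two, ← div_eq_mul_inv]
    rw [h]
    have e1 : (((2 : ℕ) : ℂ) - (θ + 1)) = 1 - θ := by push_cast; ring
    have e2 : ((θ : ℂ) + 1 - ((2 : ℕ) : ℂ)) = θ - 1 := by push_cast; ring
    rw [e1, e2, Nat.cast_ofNat, Complex.Gamma_ofNat_eq_factorial]
    simp
  rw [powerKernel, hm, mul_sinc_mul_pi, Complex.Gamma_add_one _ (by exact_mod_cast h0),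
    mul_assoc (θ : ℂ), Complex.Gamma_mul_Gamma_one_sub, mul_comm (Real.pi : ℂ)]
  push_cast
  field_simp

/-- The scalar form of the second integral representation. -/
lemma integral_betaDist_mul_cpow_mul_cpow {θ a b : ℝ} (hθ : θ ∈ Ioo (-1 : ℝ) 1) (h0 : θ ≠ 0)
    (ha : 0 < a) (hb : 0 < b) :
    Integrable (fun t : ℝ => (betaDist θ t : ℂ) *
        ((a : ℂ) ^ (-(((1 - θ : ℝ) : ℂ) + Complex.I * (t : ℂ)) / 2) *
          (b : ℂ) ^ (-(((1 - θ : ℝ) : ℂ) - Complex.I * (t : ℂ)) / 2))) ∧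
    θ * ∫ t : ℝ, (betaDist θ t : ℂ) *
        ((a : ℂ) ^ (-(((1 - θ : ℝ) : ℂ) + Complex.I * (t : ℂ)) / 2) *
          (b : ℂ) ^ (-(((1 - θ : ℝ) : ℂ) - Complex.I * (t : ℂ)) / 2)) = powerKernel θ a b := by
  have hθ0 : (θ : ℂ) ≠ 0 := by exact_mod_cast h0
  have ha0 : (a : ℂ) ≠ 0 := by exact_mod_cast ha.ne'
  have hb0 : (b : ℂ) ≠ 0 := by exact_mod_cast hb.ne'
  set α := Real.log a with hα
  set β := Real.log b with hβ
  have hla : Complex.log a = α := (Complex.ofReal_log ha.le).symm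
  have hlb : Complex.log b = β := (Complex.ofReal_log hb.le).symm
  set r : ℝ := (β - α) / 2 with hr
  set c : ℂ := Complex.exp (-((1 - θ) * (α + β) / 2)) with hc
  have hpt : ∀ t : ℝ, (betaDist θ t : ℂ) *
        ((a : ℂ) ^ (-(((1 - θ : ℝ) : ℂ) + Complex.I * (t : ℂ)) / 2) *
          (b : ℂ) ^ (-(((1 - θ : ℝ) : ℂ) - Complex.I * (t : ℂ)) / 2)) =
      c * ((betaDist θ t : ℂ) * Complex.exp (Complex.I * r * t)) := by
    intro t
    rw [Complex.cpow_def_of_ne_zero ha0, Complex.cpow_def_of_ne_zero hb0, hla, hlb,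
      ← Complex.exp_add, hc, mul_left_comm, ← Complex.exp_add, hr]
    congr 2
    push_cast
    ring
  simp_rw [hpt]
  constructor
  · refine Integrable.const_mul ?_ c
    refine (integrable_betaDist hθ h0).mul_bdd (c := 1) ?_ ?_
    · apply Continuous.aestronglyMeasurable
      fun_prop
    · refine Eventually.of_forall fun t => ?_
      rw [Complex.norm_exp]
      simp
  · rw [integral_const_mul]
    by_cases hab : a = b
    · have hβα : β = α := by rw [hα, hβ, hab]
      have hr0 : r = 0 := by rw [hr, hβα]; simp
      simp only [hr0, Complex.ofReal_zero, mul_zero, zero_mul, Complex.exp_zero, mul_one]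
      rw [integral_betaDist hθ h0, ← hab, powerKernel_self hθ h0 ha,
        Complex.cpow_def_of_ne_zero ha0, hla, hc, hβα, mul_one]
      congr 2
      ring
    · have hne : (b : ℂ) - a ≠ 0 := by
        rw [sub_ne_zero]; exact_mod_cast Ne.symm hab
      have hT := sinh_mul_integral_betaDist_mul_exp hθ h0 r
      apply mul_left_cancel₀ hne
      rw [sub_mul_powerKernel hθ ha hb, Complex.cpow_def_of_ne_zero ha0,
        Complex.cpow_def_of_ne_zero hb0, hla, hlb]
      set T := ∫ t : ℝ, (betaDist θ t : ℂ) * Complex.exp (Complex.I * r * t)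
      have e1 : (b : ℂ) - a = Complex.exp ((α + β) / 2) * (2 * Complex.sinh r) := by
        rw [Complex.sinh, mul_div_cancel₀ _ two_ne_zero, mul_sub, ← Complex.exp_add,
          ← Complex.exp_add, ← Complex.exp_log ha0, ← Complex.exp_log hb0, hla, hlb, hr]
        push_cast
        congr 2 <;> ring
      have e2 : Complex.exp (β * θ) - Complex.exp (α * θ) =
          Complex.exp (θ * (α + β) / 2) * (2 * Complex.sinh (θ * r)) := by
        rw [Complex.sinh, mul_div_cancel₀ _ two_ne_zero, mul_sub, ← Complex.exp_add,
          ← Complex.exp_add, hr]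
        push_cast
        congr 2 <;> ring
      have e3 : Complex.exp ((α + β) / 2) * c = Complex.exp (θ * (α + β) / 2) := by
        rw [hc, ← Complex.exp_add]; congr 1; ring
      rw [e1, e2, ← hT, ← e3]
      ring

/-- The scalar form of the first integral representation. -/
lemma integral_rpow_mul_resolvents {θ a b : ℝ} (hθ : θ ∈ Ioo (-1 : ℝ) 1)
    (ha : 0 < a) (hb : 0 < b) :
    IntegrableOn (fun l : ℝ => ((l ^ θ : ℝ) : ℂ) * (((a : ℂ) + l)⁻¹ * ((b : ℂ) + l)⁻¹)) (Ioi 0) ∧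
    (θ * sinc (θ * Real.pi) : ℝ) * ∫ l in Ioi (0 : ℝ), ((l ^ θ : ℝ) : ℂ) *
      (((a : ℂ) + l)⁻¹ * ((b : ℂ) + l)⁻¹) = powerKernel θ a b := by
  have heq : ∀ l ∈ Ioi (0 : ℝ), (l : ℂ) ^ ((θ : ℂ) + 1 - 1) • resolventKernel a b l =
      ((l ^ θ : ℝ) : ℂ) * (((a : ℂ) + l)⁻¹ * ((b : ℂ) + l)⁻¹) := by
    intro l hl
    rw [add_sub_cancel_right, ← Complex.ofReal_cpow (le_of_lt hl), smul_eq_mul, resolventKernel,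
      mul_inv]
  constructor
  · exact (mellinConvergent_resolventKernel (w := θ) (Complex.ofReal_mem_slitPlane.2 ha)
      (Complex.ofReal_mem_slitPlane.2 hb) hθ.1 hθ.2).congr_fun heq measurableSet_Ioi
  · rw [powerKernel, mellin, setIntegral_congr_fun measurableSet_Ioi heq]

section Matrices

variable {n : Type*} [Fintype n] [DecidableEq n]

lemma IsHermitian.eq_conj_diagonal {M : Matrix n n ℂ} (hM : M.IsHermitian) :
    M = (hM.eigenvectorUnitary : Matrix n n ℂ) *
      Matrix.diagonal (fun i => (hM.eigenvalues i : ℂ)) *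
      star (hM.eigenvectorUnitary : Matrix n n ℂ) := by
  have h := hM.spectral_theorem
  rw [Unitary.conjStarAlgAut_apply] at h
  exact h

lemma mpow_eq_conj_diagonal {M : Matrix n n ℂ} (hM : M.IsHermitian)
    (hpos : ∀ i, 0 < hM.eigenvalues i) (w : ℂ) :
    mpow M w = (hM.eigenvectorUnitary : Matrix n n ℂ) *
      Matrix.diagonal (fun i => (hM.eigenvalues i : ℂ) ^ w) *
      star (hM.eigenvectorUnitary : Matrix n n ℂ) := by
  rw [mpow, dif_pos hM]
  simp only [(hpos _).ne', if_false]

lemma add_smul_one_eq_conj_diagonal {M : Matrix n n ℂ} (hM : M.IsHermitian) (l : ℝ) :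
    M + l • (1 : Matrix n n ℂ) = (hM.eigenvectorUnitary : Matrix n n ℂ) *
      Matrix.diagonal (fun i => (hM.eigenvalues i : ℂ) + l) *
      star (hM.eigenvectorUnitary : Matrix n n ℂ) := by
  have h1 : Matrix.diagonal (fun i => (hM.eigenvalues i : ℂ) + l) =
      Matrix.diagonal (fun i => (hM.eigenvalues i : ℂ)) + l • (1 : Matrix n n ℂ) := by
    ext i j
    by_cases h : i = j <;> simp [h]
  have hU' : (hM.eigenvectorUnitary : Matrix n n ℂ) *
      star (hM.eigenvectorUnitary : Matrix n n ℂ) = 1 := Unitary.coe_mul_star_self _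
  rw [h1, mul_add, add_mul, ← IsHermitian.eq_conj_diagonal hM, mul_smul_comm, smul_mul_assoc,
    mul_one, hU']

lemma add_smul_one_inv_eq_conj_diagonal {M : Matrix n n ℂ} (hM : M.IsHermitian)
    (hpos : ∀ i, 0 < hM.eigenvalues i) {l : ℝ} (hl : 0 ≤ l) :
    (M + l • (1 : Matrix n n ℂ))⁻¹ = (hM.eigenvectorUnitary : Matrix n n ℂ) *
      Matrix.diagonal (fun i => ((hM.eigenvalues i : ℂ) + l)⁻¹) *
      star (hM.eigenvectorUnitary : Matrix n n ℂ) := by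
  apply Matrix.inv_eq_right_inv
  rw [add_smul_one_eq_conj_diagonal hM]
  set U := (hM.eigenvectorUnitary : Matrix n n ℂ)
  have hU : star U * U = 1 := Unitary.coe_star_mul_self _
  have hU' : U * star U = 1 := Unitary.coe_mul_star_self _
  rw [show ∀ D E : Matrix n n ℂ, U * D * star U * (U * E * star U) =
    U * (D * (star U * U) * E) * star U from fun D E => by simp only [mul_assoc], hU, mul_one,
    Matrix.diagonal_mul_diagonal]
  have : (fun i => ((hM.eigenvalues i : ℂ) + l) * ((hM.eigenvalues i : ℂ) + l)⁻¹) = 1 := by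
    funext i
    have h : (0 : ℝ) < hM.eigenvalues i + l := by linarith [hpos i]
    exact mul_inv_cancel₀ (by exact_mod_cast h.ne')
  rw [this, Matrix.diagonal_one', mul_one, hU']

lemma posSemidef_sub_smul_one_iff {M : Matrix n n ℂ} (hM : M.IsHermitian) (c : ℝ) :
    (M - c • (1 : Matrix n n ℂ)).PosSemidef ↔ ∀ i, c ≤ hM.eigenvalues i := by
  have h := add_smul_one_eq_conj_diagonal hM (-c)
  rw [neg_smul, ← sub_eq_add_neg] at h
  set U := (hM.eigenvectorUnitary : Matrix n n ℂ)
  have hU : star U * U = 1 := Unitary.coe_star_mul_self _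
  have hD : (Matrix.diagonal (fun i => (hM.eigenvalues i : ℂ) + ((-c : ℝ) : ℂ))).PosSemidef ↔
      ∀ i, c ≤ hM.eigenvalues i := by
    rw [Matrix.posSemidef_diagonal_iff]
    refine forall_congr' fun i => ?_
    rw [← Complex.ofReal_add, Complex.zero_le_real]
    constructor <;> intro h <;> linarith
  rw [← hD, h]
  constructor
  · intro hP
    have := hP.conjTranspose_mul_mul_same U
    rw [← Matrix.star_eq_conjTranspose] at this
    rwa [show ∀ D : Matrix n n ℂ, star U * (U * D * star U) * U =
      (star U * U) * D * (star U * U) from fun D => by simp only [mul_assoc], hU, one_mul,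
      mul_one] at this
  · intro hP
    exact hP.mul_mul_conjTranspose_same U

/-- Uniform lower bound on the spectrum of a Hermitian perturbation. -/
lemma exists_forall_le_eigenvalues_add_smul {A H : Matrix n n ℂ} (hA : A.PosDef)
    (hH : H.IsHermitian) : ∃ m > 0, ∃ ε > 0, ∀ t : ℝ, |t| < ε →
      ∃ hB : (A + t • H).IsHermitian, ∀ i, m ≤ hB.eigenvalues i := by
  obtain ⟨a, ha, haA⟩ : ∃ a > 0, ∀ i, a ≤ hA.1.eigenvalues i := by
    rcases isEmpty_or_nonempty n with h | h
    · exact ⟨1, one_pos, fun i => h.elim i⟩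
    · obtain ⟨i, hi⟩ := Finite.exists_min hA.1.eigenvalues
      exact ⟨_, hA.eigenvalues_pos i, hi⟩
  have hbound : ∀ G : Matrix n n ℂ, G.IsHermitian →
      ∃ K : ℝ, 0 < K ∧ (G + K • (1 : Matrix n n ℂ)).PosSemidef := by
    intro G hG
    refine ⟨1 + ∑ i, |hG.eigenvalues i|, by positivity, ?_⟩
    have h := (posSemidef_sub_smul_one_iff hG (-(1 + ∑ i, |hG.eigenvalues i|))).2 (fun i => by
      have h1 : |hG.eigenvalues i| ≤ ∑ i, |hG.eigenvalues i| :=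
        Finset.single_le_sum (f := fun i => |hG.eigenvalues i|)
          (fun j _ => abs_nonneg _) (Finset.mem_univ i)
      have h2 := neg_abs_le (hG.eigenvalues i)
      linarith)
    rwa [neg_smul, sub_neg_eq_add] at h
  obtain ⟨K, hK, hKH⟩ := hbound H hH
  obtain ⟨K', hK', hKH'⟩ := hbound (-H) hH.neg
  have hAa := (posSemidef_sub_smul_one_iff hA.1 a).2 haA
  refine ⟨a / 2, by positivity, a / (2 * (K + K')), by positivity, fun t ht => ?_⟩
  have hB : (A + t • H).IsHermitian := hA.1.add (hH.smul (IsSelfAdjoint.all t))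
  refine ⟨hB, (posSemidef_sub_smul_one_iff hB _).1 ?_⟩
  rw [lt_div_iff₀ (by positivity)] at ht
  have hone : (1 : Matrix n n ℂ).PosSemidef := Matrix.PosSemidef.one
  rcases le_total 0 t with h0 | h0
  · rw [abs_of_nonneg h0] at ht
    have h1 : (0 : ℝ) ≤ a / 2 - t * K := by nlinarith
    have := (hAa.add (hKH.smul h0)).add (hone.smul h1)
    convert this using 1
    module
  · rw [abs_of_nonpos h0] at ht
    have h1 : (0 : ℝ) ≤ a / 2 - (-t) * K' := by nlinarith
    have := (hAa.add (hKH'.smul (neg_nonneg.2 h0))).add (hone.smul h1)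
    convert this using 1
    module

lemma norm_add_smul_one_inv_apply_le {M : Matrix n n ℂ} (hM : M.IsHermitian) {m : ℝ} (hm : 0 < m)
    (hle : ∀ i, m ≤ hM.eigenvalues i) {l : ℝ} (hl : 0 ≤ l) (i j : n) :
    ‖(M + l • (1 : Matrix n n ℂ))⁻¹ i j‖ ≤ Fintype.card n * (m + l)⁻¹ := by
  rw [add_smul_one_inv_eq_conj_diagonal hM (fun i => hm.trans_le (hle i)) hl, Matrix.mul_apply]
  simp only [Matrix.mul_diagonal, Matrix.star_apply]
  refine (norm_sum_le _ _).trans ?_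
  rw [← nsmul_eq_mul, ← Finset.card_univ, ← Finset.sum_const]
  refine Finset.sum_le_sum fun k _ => ?_
  have h1 := entry_norm_bound_of_unitary hM.eigenvectorUnitary.2 i k
  have h2 := entry_norm_bound_of_unitary hM.eigenvectorUnitary.2 j k
  have h3 : ‖((hM.eigenvalues k : ℂ) + l)⁻¹‖ ≤ (m + l)⁻¹ := by
    have := hle k
    rw [norm_inv, ← Complex.ofReal_add, Complex.norm_of_nonneg (by linarith)]
    gcongr
  have hml : 0 ≤ (m + l)⁻¹ := by positivity
  rw [norm_mul, norm_mul, norm_star]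
  calc _ ≤ 1 * (m + l)⁻¹ * 1 := by gcongr
    _ = _ := by ring

/-- Integrating a product of two diagonalised matrix functions. -/
lemma integral_smul_conj_diagonal {X : Type*} [MeasurableSpace X] {μ : Measure X}
    (w : X → ℝ) (p q : X → n → ℂ) (U U' H V V' : Matrix n n ℂ)
    (hw : ∀ i j, Integrable (fun x => (w x : ℂ) * (p x i * q x j)) μ) (k l : n) :
    Integrable (fun x => (w x • (U * Matrix.diagonal (p x) * U' * H *
      (V * Matrix.diagonal (q x) * V'))) k l) μ ∧
    ∫ x, (w x • (U * Matrix.diagonal (p x) * U' * H *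
      (V * Matrix.diagonal (q x) * V'))) k l ∂μ =
      (U * Matrix.of (fun i j => (∫ x, (w x : ℂ) * (p x i * q x j) ∂μ) * (U' * H * V) i j) * V')
        k l := by
  have hpt : ∀ x, (w x • (U * Matrix.diagonal (p x) * U' * H *
      (V * Matrix.diagonal (q x) * V'))) k l = ∑ j, ∑ i,
        ((w x : ℂ) * (p x i * q x j)) * (U k i * (U' * H * V) i j * V' j l) := by
    intro x
    rw [show U * Matrix.diagonal (p x) * U' * H * (V * Matrix.diagonal (q x) * V') =
      (U * (Matrix.diagonal (p x) * (U' * H * V) * Matrix.diagonal (q x))) * V' by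
        simp only [mul_assoc], Matrix.smul_apply, Matrix.mul_apply, Complex.real_smul,
      Finset.mul_sum]
    refine Finset.sum_congr rfl fun j _ => ?_
    rw [Matrix.mul_apply, Finset.sum_mul, Finset.mul_sum]
    refine Finset.sum_congr rfl fun i _ => ?_
    rw [Matrix.mul_diagonal, Matrix.diagonal_mul]
    ring
  simp_rw [hpt]
  constructor
  · exact integrable_finsetSum _ fun j _ => integrable_finsetSum _ fun i _ =>
      (hw i j).mul_const _
  · rw [integral_finsetSum _ fun j _ => integrable_finsetSum _ fun i _ => (hw i j).mul_const _,
      Matrix.mul_apply]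
    refine Finset.sum_congr rfl fun j _ => ?_
    rw [integral_finsetSum _ fun i _ => (hw i j).mul_const _, Matrix.mul_apply, Finset.sum_mul]
    refine Finset.sum_congr rfl fun i _ => ?_
    rw [integral_mul_const, Matrix.of_apply]
    ring

/-- The difference of two matrix functions through divided differences. -/
lemma conj_diagonal_sub_conj_diagonal {U V : Matrix n n ℂ} (hU : star U * U = 1)
    (hU' : U * star U = 1) (hV : star V * V = 1) (hV' : V * star V = 1) {e f g h : n → ℂ}
    {K : n → n → ℂ} (hK : ∀ i j, (f j - e i) * K i j = h j - g i) :
    V * Matrix.diagonal h * star V - U * Matrix.diagonal g * star U =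
      U * Matrix.of (fun i j => K i j * (star U *
        (V * Matrix.diagonal f * star V - U * Matrix.diagonal e * star U) * V) i j) * star V := by
  have h1 : ∀ x y : n → ℂ, star U * (V * Matrix.diagonal y * star V -
      U * Matrix.diagonal x * star U) * V =
      (star U * V) * Matrix.diagonal y - Matrix.diagonal x * (star U * V) := by
    intro x y
    calc _ = (star U * V) * Matrix.diagonal y * (star V * V) -
          (star U * U) * Matrix.diagonal x * (star U * V) := by noncomm_ring
      _ = _ := by rw [hU, hV, mul_one, one_mul]
  have h2 : Matrix.of (fun i j => K i j * (star U *
        (V * Matrix.diagonal f * star V - U * Matrix.diagonal e * star U) * V) i j) =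
      star U * (V * Matrix.diagonal h * star V - U * Matrix.diagonal g * star U) * V := by
    rw [h1, h1]
    ext i j
    simp only [Matrix.of_apply, Matrix.sub_apply, Matrix.mul_diagonal, Matrix.diagonal_mul]
    linear_combination (star U * V) i j * hK i j
  rw [h2]
  calc _ = (U * star U) * (V * Matrix.diagonal h * star V - U * Matrix.diagonal g * star U) *
        (V * star V) := by rw [hU', hV', one_mul, mul_one]
    _ = _ := by noncomm_ring

lemma integrableOn_and_smul_mIntOn_resolvents {θ : ℝ} (hθ : θ ∈ Ioo (-1 : ℝ) 1)
    {A B : Matrix n n ℂ} (hA : A.IsHermitian) (hB : B.IsHermitian)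
    (hpA : ∀ i, 0 < hA.eigenvalues i) (hpB : ∀ i, 0 < hB.eigenvalues i) (H : Matrix n n ℂ) :
    (∀ i j, IntegrableOn (fun l : ℝ => (l ^ θ • ((A + l • (1 : Matrix n n ℂ))⁻¹ * H *
      (B + l • (1 : Matrix n n ℂ))⁻¹)) i j) (Ioi 0)) ∧
    (θ * sinc (θ * Real.pi)) • mIntOn (fun l : ℝ => l ^ θ •
      ((A + l • (1 : Matrix n n ℂ))⁻¹ * H * (B + l • (1 : Matrix n n ℂ))⁻¹)) (Ioi 0) =
      (hA.eigenvectorUnitary : Matrix n n ℂ) *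
        Matrix.of (fun i j => powerKernel θ (hA.eigenvalues i) (hB.eigenvalues j) *
          (star (hA.eigenvectorUnitary : Matrix n n ℂ) * H *
            (hB.eigenvectorUnitary : Matrix n n ℂ)) i j) *
        star (hB.eigenvectorUnitary : Matrix n n ℂ) := by
  have key := integral_smul_conj_diagonal (μ := volume.restrict (Ioi (0 : ℝ)))
    (fun l => l ^ θ) (fun l i => ((hA.eigenvalues i : ℂ) + l)⁻¹)
    (fun l i => ((hB.eigenvalues i : ℂ) + l)⁻¹) (hA.eigenvectorUnitary : Matrix n n ℂ)
    (star (hA.eigenvectorUnitary : Matrix n n ℂ)) H (hB.eigenvectorUnitary : Matrix n n ℂ)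
    (star (hB.eigenvectorUnitary : Matrix n n ℂ))
    (fun i j => (integral_rpow_mul_resolvents hθ (hpA i) (hpB j)).1)
  have heq : ∀ i j, ∀ l ∈ Ioi (0 : ℝ), (l ^ θ • ((hA.eigenvectorUnitary : Matrix n n ℂ) *
      Matrix.diagonal (fun i => ((hA.eigenvalues i : ℂ) + l)⁻¹) *
      star (hA.eigenvectorUnitary : Matrix n n ℂ) * H *
      ((hB.eigenvectorUnitary : Matrix n n ℂ) *
      Matrix.diagonal (fun i => ((hB.eigenvalues i : ℂ) + l)⁻¹) *
      star (hB.eigenvectorUnitary : Matrix n n ℂ)))) i j =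
      (l ^ θ • ((A + l • (1 : Matrix n n ℂ))⁻¹ * H *
        (B + l • (1 : Matrix n n ℂ))⁻¹)) i j := by
    intro i j l hl
    rw [add_smul_one_inv_eq_conj_diagonal hA hpA (le_of_lt hl),
      add_smul_one_inv_eq_conj_diagonal hB hpB (le_of_lt hl)]
  refine ⟨fun i j => IntegrableOn.congr_fun (key i j).1 (heq i j) measurableSet_Ioi, ?_⟩
  have hof : Matrix.of (fun i j => powerKernel θ (hA.eigenvalues i) (hB.eigenvalues j) *
          (star (hA.eigenvectorUnitary : Matrix n n ℂ) * H *
            (hB.eigenvectorUnitary : Matrix n n ℂ)) i j) =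
      (θ * sinc (θ * Real.pi)) • Matrix.of (fun i j => (∫ l in Ioi (0 : ℝ), ((l ^ θ : ℝ) : ℂ) *
        (((hA.eigenvalues i : ℂ) + l)⁻¹ * ((hB.eigenvalues j : ℂ) + l)⁻¹)) *
          (star (hA.eigenvectorUnitary : Matrix n n ℂ) * H *
            (hB.eigenvectorUnitary : Matrix n n ℂ)) i j) := by
    ext i j
    rw [Matrix.smul_apply, Matrix.of_apply, Matrix.of_apply,
      ← (integral_rpow_mul_resolvents hθ (hpA i) (hpB j)).2, Complex.real_smul, mul_assoc]
  rw [hof, mul_smul_comm, smul_mul_assoc]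
  congr 1
  ext i j
  rw [← (key i j).2, mIntOn, Matrix.of_apply]
  exact (setIntegral_congr_fun measurableSet_Ioi (heq i j)).symm

lemma mpow_sub_mpow_eq_smul_mIntOn {θ : ℝ} (hθ : θ ∈ Ioo (-1 : ℝ) 1)
    {A B : Matrix n n ℂ} (hA : A.IsHermitian) (hB : B.IsHermitian)
    (hpA : ∀ i, 0 < hA.eigenvalues i) (hpB : ∀ i, 0 < hB.eigenvalues i) :
    mpow B (θ : ℂ) - mpow A (θ : ℂ) =
    (θ * sinc (θ * Real.pi)) • mIntOn (fun l : ℝ => l ^ θ •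
      ((A + l • (1 : Matrix n n ℂ))⁻¹ * (B - A) * (B + l • (1 : Matrix n n ℂ))⁻¹)) (Ioi 0) := by
  rw [(integrableOn_and_smul_mIntOn_resolvents hθ hA hB hpA hpB (B - A)).2,
    mpow_eq_conj_diagonal hA hpA, mpow_eq_conj_diagonal hB hpB,
    conj_diagonal_sub_conj_diagonal (Unitary.coe_star_mul_self hA.eigenvectorUnitary)
      (Unitary.coe_mul_star_self hA.eigenvectorUnitary)
      (Unitary.coe_star_mul_self hB.eigenvectorUnitary)
      (Unitary.coe_mul_star_self hB.eigenvectorUnitary)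
      (fun i j => sub_mul_powerKernel hθ (hpA i) (hpB j)),
    ← IsHermitian.eq_conj_diagonal hA, ← IsHermitian.eq_conj_diagonal hB]

/-- The first-order divided difference of `X ↦ X ^ θ` along `H`. -/
lemma inv_smul_mpow_sub_mpow {θ : ℝ} (hθ : θ ∈ Ioo (-1 : ℝ) 1)
    {A H : Matrix n n ℂ} (hA : A.IsHermitian) (hpA : ∀ i, 0 < hA.eigenvalues i) {t : ℝ}
    (ht : t ≠ 0) (hB : (A + t • H).IsHermitian) (hpB : ∀ i, 0 < hB.eigenvalues i) :
    t⁻¹ • (mpow (A + t • H) (θ : ℂ) - mpow A (θ : ℂ)) =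
    (θ * sinc (θ * Real.pi)) • mIntOn (fun l : ℝ => l ^ θ •
      ((A + l • (1 : Matrix n n ℂ))⁻¹ * H * (A + t • H + l • (1 : Matrix n n ℂ))⁻¹)) (Ioi 0) := by
  have h : (fun l : ℝ => l ^ θ • ((A + l • (1 : Matrix n n ℂ))⁻¹ * (A + t • H - A) *
      (A + t • H + l • (1 : Matrix n n ℂ))⁻¹)) = fun l : ℝ => t • (l ^ θ •
      ((A + l • (1 : Matrix n n ℂ))⁻¹ * H * (A + t • H + l • (1 : Matrix n n ℂ))⁻¹)) := by
    funext l
    rw [add_sub_cancel_left, mul_smul_comm, smul_mul_assoc, smul_comm]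
  rw [mpow_sub_mpow_eq_smul_mIntOn hθ hA hB hpA hpB, h, smul_comm]
  congr 1
  ext i j
  simp only [mIntOn, Matrix.smul_apply, Matrix.of_apply]
  rw [integral_smul, inv_smul_smul₀ ht]

lemma tendsto_add_smul_add_smul_one_inv {A H : Matrix n n ℂ} (hA : A.IsHermitian)
    (hpA : ∀ i, 0 < hA.eigenvalues i) {l : ℝ} (hl : 0 ≤ l) :
    Tendsto (fun t : ℝ => (A + t • H + l • (1 : Matrix n n ℂ))⁻¹) (nhds 0)
      (nhds (A + l • (1 : Matrix n n ℂ))⁻¹) := by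
  have hdet : (A + l • (1 : Matrix n n ℂ)).det ≠ 0 := by
    have hpos : ∀ i, ((hA.eigenvalues i : ℂ) + l) ≠ 0 := fun i => by
      have : (0 : ℝ) < hA.eigenvalues i + l := by linarith [hpA i]
      exact_mod_cast this.ne'
    have hU : (hA.eigenvectorUnitary : Matrix n n ℂ) *
      star (hA.eigenvectorUnitary : Matrix n n ℂ) = 1 := Unitary.coe_mul_star_self _
    rw [add_smul_one_eq_conj_diagonal hA, Matrix.det_mul, Matrix.det_mul, mul_right_comm,
      ← Matrix.det_mul, hU, Matrix.det_one, one_mul, Matrix.det_diagonal]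
    exact Finset.prod_ne_zero_iff.2 fun i _ => hpos i
  have hc : Continuous fun t : ℝ => A + t • H + l • (1 : Matrix n n ℂ) := by fun_prop
  have h0 : A + (0 : ℝ) • H + l • (1 : Matrix n n ℂ) = A + l • (1 : Matrix n n ℂ) := by
    rw [zero_smul, add_zero]
  simp only [Matrix.inv_def, Ring.inverse_eq_inv']
  have h1 : Tendsto (fun t : ℝ => (A + t • H + l • (1 : Matrix n n ℂ)).det) (nhds 0)
      (nhds (A + l • (1 : Matrix n n ℂ)).det) := by
    simpa only [h0] using hc.matrix_det.tendsto 0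
  have h2 : Tendsto (fun t : ℝ => (A + t • H + l • (1 : Matrix n n ℂ)).adjugate) (nhds 0)
      (nhds (A + l • (1 : Matrix n n ℂ)).adjugate) := by
    simpa only [h0] using hc.matrix_adjugate.tendsto 0
  exact (h1.inv₀ hdet).smul h2

lemma norm_mul_mul_apply_le {m : Type*} [Fintype m] (X H Y : Matrix m m ℂ) {x y : ℝ}
    (hx : ∀ i j, ‖X i j‖ ≤ x)
    (hy : ∀ i j, ‖Y i j‖ ≤ y) (i j : m) :
    ‖(X * H * Y) i j‖ ≤ (∑ k, ∑ l, ‖H l k‖) * (x * y) := by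
  have hx0 : 0 ≤ x := (norm_nonneg _).trans (hx i i)
  rw [Matrix.mul_apply, Finset.sum_mul]
  refine (norm_sum_le _ _).trans (Finset.sum_le_sum fun k _ => ?_)
  rw [Matrix.mul_apply, Finset.sum_mul, Finset.sum_mul]
  refine (norm_sum_le _ _).trans (Finset.sum_le_sum fun l _ => ?_)
  rw [norm_mul, norm_mul]
  calc _ ≤ x * ‖H l k‖ * y := by gcongr <;> apply_assumption
    _ = _ := by ring

lemma tendsto_mIntOn_resolvents {θ : ℝ} (hθ : θ ∈ Ioo (-1 : ℝ) 1)
    {A H : Matrix n n ℂ} (hA : A.PosDef) (hH : H.IsHermitian) :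
    Tendsto (fun t : ℝ => mIntOn (fun l : ℝ => l ^ θ • ((A + l • (1 : Matrix n n ℂ))⁻¹ * H *
      (A + t • H + l • (1 : Matrix n n ℂ))⁻¹)) (Ioi 0)) (nhds 0)
      (nhds (mIntOn (fun l : ℝ => l ^ θ • ((A + l • (1 : Matrix n n ℂ))⁻¹ * H *
        (A + l • (1 : Matrix n n ℂ))⁻¹)) (Ioi 0))) := by
  obtain ⟨m, hm, ε, hε, hB⟩ := exists_forall_le_eigenvalues_add_smul hA hH
  have hAm : ∀ i, m ≤ hA.1.eigenvalues i := by
    obtain ⟨h, h'⟩ := hB 0 (by simpa using hε)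
    simpa only [zero_smul, add_zero] using h'
  have hnear : ∀ᶠ t : ℝ in nhds 0, |t| < ε := by
    have := (continuous_abs (G := ℝ)).tendsto 0
    rw [abs_zero] at this
    exact this.eventually (gt_mem_nhds hε)
  set C : ℝ := (∑ k, ∑ l, ‖H l k‖) * ((Fintype.card n : ℝ) * Fintype.card n) with hC
  refine tendsto_pi_nhds.2 fun i => tendsto_pi_nhds.2 fun j => ?_
  simp only [mIntOn, Matrix.of_apply]
  refine tendsto_integral_filter_of_dominated_convergence
    (fun l : ℝ => C * ‖((l ^ θ : ℝ) : ℂ) * (((m : ℂ) + l)⁻¹ * ((m : ℂ) + l)⁻¹)‖) ?_ ?_ ?_ ?_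
  · filter_upwards [hnear] with t ht
    obtain ⟨h, h'⟩ := hB t ht
    exact ((integrableOn_and_smul_mIntOn_resolvents hθ hA.1 h hA.eigenvalues_pos
      (fun i => hm.trans_le (h' i)) H).1 i j).aestronglyMeasurable
  · filter_upwards [hnear] with t ht
    obtain ⟨h, h'⟩ := hB t ht
    refine (ae_restrict_iff' measurableSet_Ioi).2 (Eventually.of_forall fun l hl => ?_)
    have hl0 : (0 : ℝ) ≤ l := le_of_lt hl
    have h1 := norm_mul_mul_apply_le _ H _
      (norm_add_smul_one_inv_apply_le hA.1 hm hAm hl0)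
      (norm_add_smul_one_inv_apply_le h hm h' hl0) i j
    have h2 : ‖((m : ℂ) + l)⁻¹‖ = (m + l)⁻¹ := by
      rw [norm_inv, ← Complex.ofReal_add, Complex.norm_of_nonneg (by positivity)]
    have h3 : (0 : ℝ) ≤ l ^ θ := Real.rpow_nonneg hl0 θ
    rw [Matrix.smul_apply, norm_smul, norm_mul, norm_mul, h2, Complex.norm_real,
      Real.norm_of_nonneg h3]
    calc _ ≤ _ := mul_le_mul_of_nonneg_left h1 h3
      _ = _ := by rw [hC]; ring
  · exact (integral_rpow_mul_resolvents hθ hm hm).1.norm.const_mul C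
  · refine (ae_restrict_iff' measurableSet_Ioi).2 (Eventually.of_forall fun l hl => ?_)
    have h := ((tendsto_add_smul_add_smul_one_inv (H := H) hA.1 hA.eigenvalues_pos
      (le_of_lt hl)).const_mul ((A + l • (1 : Matrix n n ℂ))⁻¹ * H)).const_smul (l ^ θ)
    exact tendsto_pi_nhds.1 (tendsto_pi_nhds.1 h i) j

lemma smul_mInt_mpow {θ : ℝ} (hθ : θ ∈ Ioo (-1 : ℝ) 1) (h0 : θ ≠ 0)
    {A : Matrix n n ℂ} (hA : A.IsHermitian) (hpA : ∀ i, 0 < hA.eigenvalues i)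
    (H : Matrix n n ℂ) :
    θ • mInt (fun t : ℝ => betaDist θ t •
        (mpow A (-(((1 - θ : ℝ) : ℂ) + Complex.I * (t : ℂ)) / 2) * H *
          mpow A (-(((1 - θ : ℝ) : ℂ) - Complex.I * (t : ℂ)) / 2))) =
      (hA.eigenvectorUnitary : Matrix n n ℂ) *
        Matrix.of (fun i j => powerKernel θ (hA.eigenvalues i) (hA.eigenvalues j) *
          (star (hA.eigenvectorUnitary : Matrix n n ℂ) * H *
            (hA.eigenvectorUnitary : Matrix n n ℂ)) i j) *
        star (hA.eigenvectorUnitary : Matrix n n ℂ) := by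
  have key := integral_smul_conj_diagonal (μ := volume) (betaDist θ)
    (fun t i => (hA.eigenvalues i : ℂ) ^ (-(((1 - θ : ℝ) : ℂ) + Complex.I * (t : ℂ)) / 2))
    (fun t i => (hA.eigenvalues i : ℂ) ^ (-(((1 - θ : ℝ) : ℂ) - Complex.I * (t : ℂ)) / 2))
    (hA.eigenvectorUnitary : Matrix n n ℂ)
    (star (hA.eigenvectorUnitary : Matrix n n ℂ)) H (hA.eigenvectorUnitary : Matrix n n ℂ)
    (star (hA.eigenvectorUnitary : Matrix n n ℂ))
    (fun i j => (integral_betaDist_mul_cpow_mul_cpow hθ h0 (hpA i) (hpA j)).1)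
  simp_rw [← (integral_betaDist_mul_cpow_mul_cpow hθ h0 (hpA _) (hpA _)).2, mul_assoc (θ : ℂ)]
  have hof : ∀ F : n → n → ℂ, Matrix.of (fun i j => (θ : ℂ) * F i j) = θ • Matrix.of F :=
    fun F => by ext i j; simp
  rw [hof, mul_smul_comm, smul_mul_assoc]
  congr 1
  ext i j
  rw [← (key i j).2, mInt, Matrix.of_apply]
  simp_rw [mpow_eq_conj_diagonal hA hpA]

end Matrices

/-- Corollary 5 of the paper: integral representations of the Fréchet
derivative of the matrix power function `X ↦ X^θ` at a positive definite matrix `A` in a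
Hermitian direction `H`; the derivative is the limit of the difference quotients. -/
theorem frechet_derivative_mpow_integral_rep {d : ℕ}
    (A H : Matrix (Fin d) (Fin d) ℂ) (hA : A.PosDef) (hH : H.IsHermitian)
    (θ : ℝ) (hθ : θ ∈ Set.Ioo (-1 : ℝ) 1) :
    ∃ L : Matrix (Fin d) (Fin d) ℂ,
      Filter.Tendsto
        (fun t : ℝ => (t : ℝ)⁻¹ • (mpow (A + t • H) ((θ : ℝ) : ℂ) - mpow A ((θ : ℝ) : ℂ)))
        (nhdsWithin 0 {(0 : ℝ)}ᶜ) (nhds L) ∧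
      L = (θ * sinc (θ * Real.pi)) •
        mIntOn (fun l : ℝ => l ^ θ •
          ((A + l • (1 : Matrix (Fin d) (Fin d) ℂ))⁻¹ * H *
            (A + l • (1 : Matrix (Fin d) (Fin d) ℂ))⁻¹)) (Set.Ioi 0) ∧
      L = θ • mInt (fun t : ℝ => betaDist θ t •
        (mpow A (-(((1 - θ : ℝ) : ℂ) + Complex.I * (t : ℂ)) / 2) * H *
          mpow A (-(((1 - θ : ℝ) : ℂ) - Complex.I * (t : ℂ)) / 2))) := by
  refine ⟨_, ?_, rfl, ?_⟩
  · obtain ⟨m, hm, ε, hε, hB⟩ := exists_forall_le_eigenvalues_add_smul hA hH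
    refine (((tendsto_mIntOn_resolvents hθ hA hH).const_smul
      (θ * sinc (θ * Real.pi))).mono_left nhdsWithin_le_nhds).congr' ?_
    filter_upwards [self_mem_nhdsWithin,
      mem_nhdsWithin_of_mem_nhds (Metric.ball_mem_nhds (0 : ℝ) hε)] with t ht hεt
    obtain ⟨h, h'⟩ := hB t (by simpa using hεt)
    exact (inv_smul_mpow_sub_mpow hθ hA.1 hA.eigenvalues_pos ht h
      fun i => hm.trans_le (h' i)).symm
  · rcases eq_or_ne θ 0 with h0 | h0
    · simp only [h0, zero_mul, zero_smul]
    · rw [smul_mInt_mpow hθ h0 hA.1 hA.eigenvalues_pos,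
        (integrableOn_and_smul_mIntOn_resolvents hθ hA.1 hA.1 hA.eigenvalues_pos
          hA.eigenvalues_pos H).2]

end QHT
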